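/- Let A be an n×n matrix over a commutative ring K such that Tr(A^i) = 0 for every i ∈ {1, 2, ..., n}. Then n!·A^n = 0. -/

import Mathlib

open Matrix

open Polynomial in
/-- The derivative of a determinant is obtained by differentiating one row at a time. -/
theorem derivative_det_eq_sum_updateRow {R ι : Type*} [CommRing R] [Fintype ι] [DecidableEq ι]
    (M : Matrix ι ι R[X]) :
    derivative M.det = ∑ i, (M.updateRow i fun j => derivative (M i j)).det := by
  simp only [← det_transpose M, ← det_transpose (updateRow _ _ _), det_apply, transpose_apply,
    map_sum]
  rw [Finset.sum_comm]
  refine Finset.sum_congr rfl fun σ _ => ?_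
  rw [← Finset.smul_sum, Units.smul_def, map_zsmul, Units.smul_def, derivative_prod_finset]
  congr 1
  refine Finset.sum_congr rfl fun i _ => ?_
  rw [← Finset.mul_prod_erase _ _ (Finset.mem_univ i), updateRow_self, mul_comm]
  congr 1
  refine Finset.prod_congr rfl fun j hj => ?_
  rw [updateRow_ne (Finset.ne_of_mem_erase hj)]

open Polynomial in
theorem derivative_charpoly_eq_trace_adjugate {R ι : Type*} [CommRing R] [Fintype ι]
    [DecidableEq ι] (A : Matrix ι ι R) :
    derivative A.charpoly = A.charmatrix.adjugate.trace := by
  rw [charpoly, derivative_det_eq_sum_updateRow, trace]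
  refine Finset.sum_congr rfl fun i _ => ?_
  rw [diag_apply, adjugate_apply]
  congr 2
  ext1 j
  by_cases hij : i = j
  · subst hij
    simp [charmatrix_apply_eq]
  · simp [charmatrix_apply_ne _ _ _ hij, Pi.single_eq_of_ne' hij]

open Polynomial in
/-- If the traces of `A, …, A ^ n` vanish, then Newton's identities reduce to the vanishing of
multiples of the coefficients of the characteristic polynomial. -/
theorem card_sub_mul_charpoly_coeff_eq_zero {R ι : Type*} [CommRing R] [Fintype ι]
    [DecidableEq ι] (A : Matrix ι ι R)
    (h : ∀ i ∈ Finset.Icc 1 (Fintype.card ι), (A ^ i).trace = 0) (j : ℕ) :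
    ((Fintype.card ι : R) - j) * A.charpoly.coeff j = 0 := by
  nontriviality R
  set Q := matPolyEquiv A.charmatrix.adjugate with hQ
  have hmul : (X - C A) * Q = A.charpoly.map (algebraMap R (Matrix ι ι R)) := by
    rw [← matPolyEquiv_charmatrix, hQ, ← map_mul, mul_adjugate, ← charpoly, matPolyEquiv_smul_one]
  have hrec (j : ℕ) : Q.coeff j = A * Q.coeff (j + 1) + A.charpoly.coeff (j + 1) • 1 := by
    have := congrArg (coeff · (j + 1)) hmul
    simp only [sub_mul, coeff_sub, coeff_X_mul, coeff_C_mul, coeff_map,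
      Algebra.algebraMap_eq_smul_one] at this
    rw [← this, add_sub_cancel]
  have hzero : A * Q.coeff 0 + A.charpoly.coeff 0 • 1 = 0 := by
    have := congrArg (coeff · 0) hmul
    simp only [sub_mul, coeff_sub, coeff_X_mul_zero, coeff_C_mul, coeff_map,
      Algebra.algebraMap_eq_smul_one] at this
    rw [← this, zero_sub, add_neg_cancel]
  have htrace (j : ℕ) : (Q.coeff j).trace = A.charpoly.coeff (j + 1) * (j + 1) := by
    rw [← coeff_derivative, derivative_charpoly_eq_trace_adjugate, trace, trace, finsetSum_coeff]
    simp [hQ, matPolyEquiv_coeff_apply]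
  have hvanish (d : ℕ) : ∀ j m : ℕ, Q.natDegree < j + d → 1 ≤ m → m ≤ j + 1 →
      (A ^ m * Q.coeff j).trace = 0 := by
    induction d with
    | zero =>
      intro j m hj _ _
      rw [coeff_eq_zero_of_natDegree_lt (by simpa using hj), mul_zero, trace_zero]
    | succ d ih =>
      intro j m hj hm hmj
      rw [hrec, mul_add, ← mul_assoc, ← pow_succ, trace_add,
        ih (j + 1) (m + 1) (by omega) (by omega) (by omega), Matrix.mul_smul, mul_one,
        trace_smul, zero_add]
      by_cases hjn : j + 1 ≤ Fintype.card ι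
      · rw [h m (Finset.mem_Icc.mpr ⟨hm, hmj.trans hjn⟩), smul_zero]
      · rw [coeff_eq_zero_of_natDegree_lt (by rw [charpoly_natDegree_eq_dim]; omega), zero_smul]
  have hone (j : ℕ) : (A * Q.coeff j).trace = 0 := by
    simpa using hvanish (Q.natDegree + 1) j 1 (by omega) le_rfl (by omega)
  cases j with
  | zero =>
    have := congrArg trace hzero
    rw [trace_add, hone, trace_smul, trace_one, trace_zero, smul_eq_mul] at this
    linear_combination this
  | succ j =>
    have := congrArg trace (hrec j)
    rw [htrace, trace_add, hone, trace_smul, trace_one, smul_eq_mul] at this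
    push_cast
    linear_combination -this

theorem stmt_5 (K : Type*) [CommRing K] (n : ℕ)
    (A : Matrix (Fin n) (Fin n) K)
    (h : ∀ i ∈ Finset.Icc 1 n, Matrix.trace (A ^ i) = 0) :
    (n.factorial : K) • A ^ n = 0 := by
  nontriviality K
  have hcoeff (j : ℕ) (hj : j < n) : (n.factorial : K) * A.charpoly.coeff j = 0 := by
    have hzero := card_sub_mul_charpoly_coeff_eq_zero A (by simpa using h) j
    rw [Fintype.card_fin, ← Nat.cast_sub hj.le] at hzero
    obtain ⟨c, hc⟩ := Nat.dvd_factorial (Nat.sub_pos_of_lt hj) (Nat.sub_le n j)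
    rw [hc, Nat.cast_mul, mul_right_comm, hzero, zero_mul]
  have hdeg : A.charpoly.natDegree = n := by simp
  have hlead : A.charpoly.coeff n = 1 := by
    simpa [hdeg] using A.charpoly_monic.coeff_natDegree
  have hCH := congrArg ((n.factorial : K) • ·) A.aeval_self_charpoly
  simp only [Polynomial.aeval_eq_sum_range, hdeg, Finset.sum_range_succ, hlead, one_smul, smul_add,
    Finset.smul_sum, smul_smul, smul_zero] at hCH
  rwa [Finset.sum_eq_zero fun j hj => by rw [hcoeff j (Finset.mem_range.mp hj), zero_smul],
    zero_add] at hCH
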